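/- Union bound estimate for MAP decoding: if the transmitted codeword λ_s is drawn from a finite set Λ_s with probabilities p(λ_s), y = λ_s + z with z ~ N(0,σ²Iₙ), and every pair of distinct codewords satisfies ‖λ_s − λ̂_s‖ ≥ d_min > 0, then the MAP decoding error probability satisfies P_e ≤ (1/2)·Σ_{λ_s} Σ_{λ̂_s ≠ λ_s} p(λ_s)·erfc(√A + B/√A), with A = d_min²/(8σ²) and B = (1/4)ln(p(λ_s)/p(λ̂_s)). -/

import Mathlib

open MeasureTheory ProbabilityTheory

/-- The complementary error function `erfc(t) = (2/√π) ∫_t^∞ e^{−u²} du`. -/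
noncomputable def erfc (t : ℝ) : ℝ :=
  (2 / Real.sqrt Real.pi) * ∫ u in Set.Ioi t, Real.exp (-u ^ 2)

lemma integrable_exp_neg_sq : Integrable (fun u : ℝ => Real.exp (-u ^ 2)) := by
  simpa using integrable_exp_neg_mul_sq (b := 1) one_pos

lemma hasDerivAt_erfc (t : ℝ) :
    HasDerivAt erfc (-((2 / Real.sqrt Real.pi) * Real.exp (-t ^ 2))) t := by
  have hc : Continuous (fun u : ℝ => Real.exp (-u ^ 2)) := by fun_prop
  have h1 : erfc = fun t => (2 / Real.sqrt Real.pi) *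
      ((∫ u in Set.Ioi (0:ℝ), Real.exp (-u ^ 2)) - ∫ u in (0:ℝ)..t, Real.exp (-u ^ 2)) := by
    funext t
    unfold erfc
    rw [← intervalIntegral.integral_Ioi_sub_Ioi' integrable_exp_neg_sq.integrableOn
      integrable_exp_neg_sq.integrableOn]
    ring
  rw [h1]
  have h2 := intervalIntegral.integral_hasDerivAt_right (hc.intervalIntegrable 0 t)
    (hc.stronglyMeasurableAtFilter _ _) hc.continuousAt
  have h3 := (h2.const_sub (∫ u in Set.Ioi (0:ℝ), Real.exp (-u ^ 2))).const_mul
    (2 / Real.sqrt Real.pi)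
  rw [mul_neg] at h3
  exact h3

lemma pair_antitone (a b B : ℝ) (ha : 0 < a) (hb : 0 < b)
    (hB : B = (1 / 4) * Real.log (a / b)) :
    AntitoneOn (fun x : ℝ => a * erfc (x + B / x) + b * erfc (x + (-B) / x)) (Set.Ioi 0) := by
  have key : ∀ x ∈ Set.Ioi (0:ℝ), HasDerivAt
      (fun x : ℝ => a * erfc (x + B / x) + b * erfc (x + (-B) / x))
      (a * (-((2 / Real.sqrt Real.pi) * Real.exp (-(x + B / x) ^ 2)) * (1 + -B / x ^ 2)) +
       b * (-((2 / Real.sqrt Real.pi) * Real.exp (-(x + (-B) / x) ^ 2)) * (1 + B / x ^ 2))) x := by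
    intro x hx
    have hx0 : x ≠ 0 := ne_of_gt hx
    have d : ∀ C : ℝ, HasDerivAt (fun x : ℝ => x + C / x) (1 + -C / x ^ 2) x := by
      intro C
      have := (hasDerivAt_id' x).add (((hasDerivAt_inv hx0).const_mul C))
      rw [show 1 + -C / x ^ 2 = 1 + C * -(x ^ 2)⁻¹ by ring]
      exact this
    have d1 := (hasDerivAt_erfc (x + B / x)).comp x (d B)
    have d2 := (hasDerivAt_erfc (x + (-B) / x)).comp x (d (-B))
    rw [neg_neg] at d2
    exact (d1.const_mul a).add (d2.const_mul b)
  apply antitoneOn_of_deriv_nonpos (convex_Ioi 0)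
  · intro x hx
    exact (key x hx).continuousAt.continuousWithinAt
  · intro x hx
    rw [interior_Ioi] at hx
    exact (key x hx).differentiableAt.differentiableWithinAt
  · intro x hx
    rw [interior_Ioi] at hx
    rw [(key x hx).deriv]
    have hx0 : x ≠ 0 := ne_of_gt hx
    have hab : a = b * Real.exp (4 * B) := by
      rw [hB, show 4 * (1 / 4 * Real.log (a / b)) = Real.log (a / b) by ring,
        Real.exp_log (by positivity)]
      field_simp
    have he : Real.exp (-(x + (-B) / x) ^ 2) =
        Real.exp (4 * B) * Real.exp (-(x + B / x) ^ 2) := by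
      rw [← Real.exp_add]
      congr 1
      field_simp
      ring
    rw [he]
    have : a * (-((2 / Real.sqrt Real.pi) * Real.exp (-(x + B / x) ^ 2)) * (1 + -B / x ^ 2)) +
       b * (-((2 / Real.sqrt Real.pi) * (Real.exp (4 * B) * Real.exp (-(x + B / x) ^ 2))) *
        (1 + B / x ^ 2)) =
        -(2 * (a * ((2 / Real.sqrt Real.pi) * Real.exp (-(x + B / x) ^ 2)))) := by
      rw [hab]; ring
    rw [this]
    have : 0 < a * ((2 / Real.sqrt Real.pi) * Real.exp (-(x + B / x) ^ 2)) := by positivity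
    linarith

lemma gaussian_Iic (s c : ℝ) (hs : 0 < s) :
    (gaussianReal 0 ((s ^ 2).toNNReal) (Set.Iic (-c))).toReal =
      (1 / 2) * erfc (c / (Real.sqrt 2 * s)) := by
  have hv : ((s ^ 2).toNNReal) ≠ 0 := by
    simp only [ne_eq, Real.toNNReal_eq_zero, not_le]; positivity
  have hk : 0 < Real.sqrt 2 * s := by positivity
  have hk2 : (Real.sqrt 2 * s) ^ 2 = 2 * s ^ 2 := by
    rw [mul_pow, Real.sq_sqrt (by norm_num)]
  rw [gaussianReal_apply_eq_integral _ hv, ENNReal.toReal_ofReal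
    (integral_nonneg fun x => gaussianPDFReal_nonneg _ _ _)]
  have h1 := integral_comp_neg_Ioi c (fun x => gaussianPDFReal 0 ((s ^ 2).toNNReal) x)
  rw [← h1]
  have h2 := integral_comp_mul_left_Ioi
    (fun x => gaussianPDFReal 0 ((s ^ 2).toNNReal) (-x)) (c / (Real.sqrt 2 * s)) hk
  rw [mul_div_cancel₀ _ hk.ne'] at h2
  have h3 : (∫ x in Set.Ioi c, gaussianPDFReal 0 ((s ^ 2).toNNReal) (-x)) =
      (Real.sqrt 2 * s) * ∫ x in Set.Ioi (c / (Real.sqrt 2 * s)),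
        gaussianPDFReal 0 ((s ^ 2).toNNReal) (-(Real.sqrt 2 * s * x)) := by
    rw [h2, smul_eq_mul, mul_inv_cancel_left₀ hk.ne']
  rw [h3]
  unfold erfc
  have h4 : ∀ x, gaussianPDFReal 0 ((s ^ 2).toNNReal) (-(Real.sqrt 2 * s * x)) =
      (Real.sqrt 2 * s * Real.sqrt Real.pi)⁻¹ * Real.exp (-x ^ 2) := by
    intro x
    rw [gaussianPDFReal, Real.coe_toNNReal _ (by positivity)]
    congr 1
    · rw [show 2 * Real.pi * s ^ 2 = (2 * Real.pi) * s ^ 2 by ring,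
        Real.sqrt_mul (by positivity), Real.sqrt_mul (by positivity), Real.sqrt_sq hs.le]
      congr 1; ring
    · congr 1
      rw [sub_zero, neg_sq, mul_pow, hk2]
      field_simp
  simp_rw [h4]
  rw [integral_const_mul]
  have := Real.sqrt_pos.2 Real.pi_pos
  field_simp

lemma map_linear (n : ℕ) (σ : ℝ) (d : Fin n → ℝ) :
    Measure.map (fun z : Fin n → ℝ => ∑ i, d i * z i)
      (Measure.pi fun _ : Fin n => gaussianReal 0 ((σ ^ 2).toNNReal)) =
    gaussianReal 0 (((σ * Real.sqrt (∑ i, d i ^ 2)) ^ 2).toNNReal) := by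
  have hm : Measurable (fun z : Fin n → ℝ => ∑ i, d i * z i) := by fun_prop
  haveI := Measure.isProbabilityMeasure_map
    (μ := Measure.pi fun _ : Fin n => gaussianReal 0 ((σ ^ 2).toNNReal)) hm.aemeasurable
  apply Measure.ext_of_charFun
  funext t
  rw [charFun_gaussianReal, charFun_apply_real, integral_map hm.aemeasurable (by fun_prop)]
  have h1 : ∀ z : Fin n → ℝ, Complex.exp (t * ((∑ i, d i * z i : ℝ) : ℂ) * Complex.I) =
      ∏ i, Complex.exp (((t * d i : ℝ) : ℂ) * (z i : ℂ) * Complex.I) := by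
    intro z
    rw [← Complex.exp_sum]
    congr 1
    push_cast
    rw [Finset.mul_sum, Finset.sum_mul]
    exact Finset.sum_congr rfl fun i _ => by ring
  simp_rw [h1]
  rw [integral_fintype_prod_eq_prod (𝕜 := ℂ)
    (f := fun i (x : ℝ) => Complex.exp (((t * d i : ℝ) : ℂ) * (x : ℂ) * Complex.I))]
  simp_rw [← charFun_apply_real, charFun_gaussianReal]
  rw [← Complex.exp_sum]
  congr 1
  rw [Real.coe_toNNReal _ (by positivity), Real.coe_toNNReal _ (by positivity), mul_pow,
    Real.sq_sqrt (Finset.sum_nonneg fun i _ => sq_nonneg _)]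
  push_cast
  simp only [mul_zero, zero_mul, zero_sub]
  rw [Finset.sum_neg_distrib, Finset.mul_sum, Finset.sum_mul, Finset.sum_div]
  congr 1
  exact Finset.sum_congr rfl fun i _ => by ring

/-- Union bound estimate on the error probability of MAP decoding: with codewords from a
finite set `Λs` with prior `p`, AWGN `z ∼ N(0,σ²Iₙ)`, and minimum distance `d_min`,
`P_e ≤ (1/2)·Σ_{λ}Σ_{λ̂≠λ} p(λ)·erfc(√A + B/√A)` where `A = d_min²/(8σ²)`,
`B = (1/4)ln(p(λ)/p(λ̂))`. -/
theorem map_union_bound_estimate (n : ℕ) (σ : ℝ) (hσ : 0 < σ)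
    (Λs : Finset (Fin n → ℝ)) (hΛs : Λs.Nonempty)
    (p : (Fin n → ℝ) → ℝ) (hp_pos : ∀ l ∈ Λs, 0 < p l) (hp_sum : ∑ l ∈ Λs, p l = 1)
    (dmin : ℝ) (hdmin : 0 < dmin)
    (hdist : ∀ l ∈ Λs, ∀ lh ∈ Λs, l ≠ lh →
      dmin ≤ Real.sqrt (∑ i, (l i - lh i) ^ 2))
    {Ω : Type*} [MeasurableSpace Ω] (P : Measure Ω) [IsProbabilityMeasure P]
    (z : Ω → Fin n → ℝ) (hz_meas : Measurable z)
    (hz : Measure.map z P =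
      Measure.pi fun _ : Fin n => gaussianReal 0 ((σ ^ 2).toNNReal))
    (dec : (Fin n → ℝ) → (Fin n → ℝ))
    (hdec_mem : ∀ y, dec y ∈ Λs)
    (hdec_opt : ∀ y, ∀ l ∈ Λs,
      -Real.log (p (dec y)) + (∑ i, (y i - dec y i) ^ 2) / (2 * σ ^ 2) ≤
        -Real.log (p l) + (∑ i, (y i - l i) ^ 2) / (2 * σ ^ 2)) :
    ∑ l ∈ Λs, p l * (P {ω | dec (fun i => l i + z ω i) ≠ l}).toReal ≤
      (1 / 2) * ∑ l ∈ Λs, ∑ lh ∈ Λs.erase l,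
        p l * erfc (Real.sqrt (dmin ^ 2 / (8 * σ ^ 2)) +
          ((1 / 4) * Real.log (p l / p lh)) / Real.sqrt (dmin ^ 2 / (8 * σ ^ 2))) := by
  classical
  set x₀ := Real.sqrt (dmin ^ 2 / (8 * σ ^ 2)) with hx₀
  have h8 : Real.sqrt (8 * σ ^ 2) = 2 * Real.sqrt 2 * σ := by
    rw [show 8 * σ ^ 2 = (2 * Real.sqrt 2 * σ) ^ 2 by
      rw [mul_pow, mul_pow, Real.sq_sqrt (by norm_num)]; ring]
    exact Real.sqrt_sq (by positivity)
  have hx₀' : x₀ = dmin / (2 * Real.sqrt 2 * σ) := by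
    rw [hx₀, Real.sqrt_div (by positivity), Real.sqrt_sq hdmin.le, h8]
  have hx₀pos : 0 < x₀ := by rw [hx₀']; positivity
  let D : (Fin n → ℝ) → (Fin n → ℝ) → ℝ := fun l lh => Real.sqrt (∑ i, (l i - lh i) ^ 2)
  let X : (Fin n → ℝ) → (Fin n → ℝ) → ℝ := fun l lh => D l lh / (2 * Real.sqrt 2 * σ)
  let G : ℝ → (Fin n → ℝ) → (Fin n → ℝ) → ℝ := fun x l lh =>
    p l * erfc (x + ((1 / 4) * Real.log (p l / p lh)) / x)
  have hD : ∀ l ∈ Λs, ∀ lh ∈ Λs, l ≠ lh → 0 < D l lh := fun l hl lh hlh h =>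
    hdmin.trans_le (hdist l hl lh hlh h)
  -- pairwise error probability
  have hpair : ∀ l ∈ Λs, ∀ lh ∈ Λs, l ≠ lh →
      (P {ω | -Real.log (p lh) + (∑ i, (l i + z ω i - lh i) ^ 2) / (2 * σ ^ 2) ≤
        -Real.log (p l) + (∑ i, (l i + z ω i - l i) ^ 2) / (2 * σ ^ 2)}).toReal =
      (1 / 2) * erfc (X l lh + ((1 / 4) * Real.log (p l / p lh)) / X l lh) := by
    intro l hl lh hlh hne
    have hDp := hD l hl lh hlh hne
    have hD2 : D l lh ^ 2 = ∑ i, (l i - lh i) ^ 2 :=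
      Real.sq_sqrt (Finset.sum_nonneg fun i _ => sq_nonneg _)
    set c := D l lh ^ 2 / 2 + σ ^ 2 * Real.log (p l / p lh) with hc
    have hset : {ω | -Real.log (p lh) + (∑ i, (l i + z ω i - lh i) ^ 2) / (2 * σ ^ 2) ≤
        -Real.log (p l) + (∑ i, (l i + z ω i - l i) ^ 2) / (2 * σ ^ 2)} =
        z ⁻¹' ((fun w : Fin n → ℝ => ∑ i, (l i - lh i) * w i) ⁻¹' Set.Iic (-c)) := by
      ext ω
      simp only [Set.mem_setOf_eq, Set.mem_preimage, Set.mem_Iic]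
      have e1 : ∑ i, (l i + z ω i - lh i) ^ 2 =
          D l lh ^ 2 + 2 * ∑ i, (l i - lh i) * z ω i + ∑ i, (l i + z ω i - l i) ^ 2 := by
        rw [hD2, Finset.mul_sum, ← Finset.sum_add_distrib, ← Finset.sum_add_distrib]
        exact Finset.sum_congr rfl fun i _ => by ring
      rw [e1, hc, Real.log_div (hp_pos l hl).ne' (hp_pos lh hlh).ne']
      generalize ∑ i, (l i + z ω i - l i) ^ 2 = S
      generalize ∑ i, (l i - lh i) * z ω i = T
      generalize Real.log (p l) = u
      generalize Real.log (p lh) = v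
      have hs2 : 0 < 2 * σ ^ 2 := by positivity
      have e2 : (-v + (D l lh ^ 2 + 2 * T + S) / (2 * σ ^ 2)) - (-u + S / (2 * σ ^ 2)) =
          (T + (D l lh ^ 2 / 2 + σ ^ 2 * (u - v))) / σ ^ 2 := by
        field_simp
        ring
      rw [← sub_nonpos, e2, div_le_iff₀ (by positivity), zero_mul]
      constructor <;> intro h <;> linarith
    have hm : Measurable (fun w : Fin n → ℝ => ∑ i, (l i - lh i) * w i) := by fun_prop
    rw [hset, ← Measure.map_apply hz_meas (hm measurableSet_Iic), hz,
      ← Measure.map_apply hm measurableSet_Iic, map_linear n σ (fun i => l i - lh i),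
      gaussian_Iic _ _ (mul_pos hσ hDp)]
    congr 2
    change c / (Real.sqrt 2 * (σ * D l lh)) = D l lh / (2 * Real.sqrt 2 * σ) +
      ((1 / 4) * Real.log (p l / p lh)) / (D l lh / (2 * Real.sqrt 2 * σ))
    rw [hc]
    have h2 : Real.sqrt 2 ^ 2 = 2 := Real.sq_sqrt (by norm_num)
    field_simp
    rw [h2]
    ring
  -- union bound
  have hunion : ∀ l ∈ Λs, (P {ω | dec (fun i => l i + z ω i) ≠ l}).toReal ≤
      ∑ lh ∈ Λs.erase l,
        (1 / 2) * erfc (X l lh + ((1 / 4) * Real.log (p l / p lh)) / X l lh) := by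
    intro l hl
    have hsub : {ω | dec (fun i => l i + z ω i) ≠ l} ⊆ ⋃ lh ∈ Λs.erase l,
        {ω | -Real.log (p lh) + (∑ i, (l i + z ω i - lh i) ^ 2) / (2 * σ ^ 2) ≤
        -Real.log (p l) + (∑ i, (l i + z ω i - l i) ^ 2) / (2 * σ ^ 2)} := by
      intro ω hω
      simp only [Set.mem_iUnion]
      exact ⟨dec (fun i => l i + z ω i), Finset.mem_erase.2 ⟨hω, hdec_mem _⟩,
        hdec_opt _ l hl⟩
    refine (measureReal_mono hsub (measure_ne_top _ _)).trans ((measureReal_biUnion_finset_le _ _).trans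
      (Finset.sum_le_sum fun lh hlh => ?_))
    have := Finset.mem_erase.1 hlh
    exact (hpair l hl lh this.2 (Ne.symm this.1)).le
  -- symmetrization
  have hsymm : ∀ g : (Fin n → ℝ) → (Fin n → ℝ) → ℝ,
      ∑ l ∈ Λs, ∑ lh ∈ Λs.erase l, g l lh =
      (1 / 2) * ∑ l ∈ Λs, ∑ lh ∈ Λs.erase l, (g l lh + g lh l) := by
    intro g
    have : ∑ l ∈ Λs, ∑ lh ∈ Λs.erase l, g lh l = ∑ l ∈ Λs, ∑ lh ∈ Λs.erase l, g l lh := by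
      apply Finset.sum_comm'
      intro x y
      simp only [Finset.mem_erase]
      tauto
    simp_rw [Finset.sum_add_distrib]
    rw [this]
    ring
  have hDsymm : ∀ l lh, X l lh = X lh l := by
    intro l lh
    have : ∀ i, (l i - lh i) ^ 2 = (lh i - l i) ^ 2 := fun i => by ring
    simp only [X, D, this]
  calc ∑ l ∈ Λs, p l * (P {ω | dec (fun i => l i + z ω i) ≠ l}).toReal
      ≤ ∑ l ∈ Λs, p l * ∑ lh ∈ Λs.erase l,
        (1 / 2) * erfc (X l lh + ((1 / 4) * Real.log (p l / p lh)) / X l lh) :=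
        Finset.sum_le_sum fun l hl =>
          mul_le_mul_of_nonneg_left (hunion l hl) (hp_pos l hl).le
    _ = (1 / 2) * ∑ l ∈ Λs, ∑ lh ∈ Λs.erase l, G (X l lh) l lh := by
        simp only [Finset.mul_sum]
        exact Finset.sum_congr rfl fun l _ => Finset.sum_congr rfl fun lh _ => by
          simp only [G]; ring
    _ ≤ (1 / 2) * ∑ l ∈ Λs, ∑ lh ∈ Λs.erase l, G x₀ l lh := by
        refine mul_le_mul_of_nonneg_left ?_ (by norm_num)
        rw [hsymm (fun l lh => G (X l lh) l lh), hsymm (fun l lh => G x₀ l lh)]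
        refine mul_le_mul_of_nonneg_left ?_ (by norm_num)
        refine Finset.sum_le_sum fun l hl => Finset.sum_le_sum fun lh hlh => ?_
        obtain ⟨hne, hlh⟩ := Finset.mem_erase.1 hlh
        have hle : x₀ ≤ X l lh := by
          rw [hx₀']
          exact div_le_div_of_nonneg_right (hdist l hl lh hlh (Ne.symm hne)) (by positivity)
        have hlog : (1 / 4) * Real.log (p lh / p l) = -((1 / 4) * Real.log (p l / p lh)) := by
          rw [← inv_div (p l) (p lh), Real.log_inv]; ring
        have := pair_antitone (p l) (p lh) _ (hp_pos l hl) (hp_pos lh hlh) rfl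
          (Set.mem_Ioi.2 hx₀pos) (Set.mem_Ioi.2 (hx₀pos.trans_le hle)) hle
        simp only [G]
        rw [hDsymm lh l, hlog]
        exact this
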